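/- Suppose 1/3 < m < 1 and fix T > 0. Then there exist p ≥ 2 and a constant C_p (depending on T) such that for all 0 ≤ s < ℓ ≤ T, ∫_{(s,ℓ]×ℝ} 𝒰(t,x)^{p(m−1)/2 + 1} dt dx ≤ C_p (ℓ − s). -/

import Mathlib

open MeasureTheory Real Set

/-- The constant k̃ = (1-m)/(2(m+1)m). -/
noncomputable def ktilde (m : ℝ) : ℝ := (1 - m) / (2 * (m + 1) * m)

/-- The constant I = ∫_{-π/2}^{π/2} (cos x)^{2m/(1-m)} dx. -/
noncomputable def Iconst (m : ℝ) : ℝ := ∫ x in (-(π/2))..(π/2), Real.cos x ^ (2*m/(1-m))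

/-- The constant D = (I/√k̃)^{2(1-m)/(m+1)}. -/
noncomputable def Dconst (m : ℝ) : ℝ := (Iconst m / Real.sqrt (ktilde m)) ^ (2*(1-m)/(m+1))

/-- The Barenblatt function 𝒰(t,x) = t^{-α}(D + k̃ x² t^{-2α})^{-1/(1-m)}, α = 1/(m+1). -/
noncomputable def barenblatt (m t x : ℝ) : ℝ :=
  t ^ (-(1/(m+1))) * (Dconst m + ktilde m * x^2 * t ^ (-(2*(1/(m+1))))) ^ (-(1/(1-m)))

theorem Iconst_pos {m : ℝ} (h0 : 0 < m) (h1 : m < 1) : 0 < Iconst m := by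
  have he : 0 ≤ 2 * m / (1 - m) := div_nonneg (by linarith) (by linarith)
  refine intervalIntegral.intervalIntegral_pos_of_pos_on ?_ ?_ (by linarith [Real.pi_pos])
  · exact (Real.continuous_cos.rpow_const fun _ => Or.inr he).intervalIntegrable _ _
  · exact fun x hx => Real.rpow_pos_of_pos (Real.cos_pos_of_mem_Ioo hx) _

theorem ktilde_pos {m : ℝ} (h0 : 0 < m) (h1 : m < 1) : 0 < ktilde m :=
  div_pos (by linarith) (by positivity)

theorem Dconst_pos {m : ℝ} (h0 : 0 < m) (h1 : m < 1) : 0 < Dconst m :=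
  Real.rpow_pos_of_pos (div_pos (Iconst_pos h0 h1) (Real.sqrt_pos.2 (ktilde_pos h0 h1))) _

theorem integrable_add_mul_sq_rpow_neg {a b r : ℝ} (ha : 0 < a) (hb : 0 < b) (hr : 1 < 2 * r) :
    Integrable fun y : ℝ => (a + b * y ^ 2) ^ (-r) := by
  have hc : 0 < min a b := lt_min ha hb
  have h := (integrable_rpow_neg_one_add_norm_sq (E := ℝ) (μ := volume) (r := 2 * r)
    (by simpa using hr)).const_mul (min a b ^ (-r))
  refine h.mono' ?_ (Filter.Eventually.of_forall fun y => ?_)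
  · exact (by fun_prop : Measurable fun y : ℝ => (a + b * y ^ 2) ^ (-r)).aestronglyMeasurable
  · have hpos : 0 < a + b * y ^ 2 := by positivity
    rw [Real.norm_of_nonneg (Real.rpow_nonneg hpos.le _), Real.norm_eq_abs, sq_abs,
      show -(2 * r) / 2 = -r by ring, ← Real.mul_rpow hc.le (by positivity)]
    refine Real.rpow_le_rpow_of_nonpos (by positivity) ?_ (by linarith)
    nlinarith [min_le_left a b, mul_le_mul_of_nonneg_right (min_le_right a b) (sq_nonneg y)]

theorem barenblatt_rpow_self {m t : ℝ} (h0 : 0 < m) (h1 : m < 1) (ht : 0 < t) (x : ℝ) :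
    barenblatt m t x ^ m = t ^ (-(m / (m + 1))) *
      (Dconst m + ktilde m * (x * t ^ (-(1 / (m + 1)))) ^ 2) ^ (-(m / (1 - m))) := by
  have hD := Dconst_pos h0 h1
  have hk := ktilde_pos h0 h1
  have hsq : t ^ (-(2 * (1 / (m + 1)))) = (t ^ (-(1 / (m + 1)))) ^ 2 := by
    rw [← Real.rpow_natCast, ← Real.rpow_mul ht.le]
    congr 1
    push_cast
    ring
  have hB : 0 ≤ Dconst m + ktilde m * (x * t ^ (-(1 / (m + 1)))) ^ 2 := by positivity
  rw [barenblatt, hsq, mul_assoc (ktilde m), ← mul_pow,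
    Real.mul_rpow (Real.rpow_nonneg ht.le _) (Real.rpow_nonneg hB _), ← Real.rpow_mul ht.le,
    ← Real.rpow_mul hB]
  congr 2 <;> ring

theorem lintegral_barenblatt_rpow_self {m t : ℝ} (hm : 1 / 3 < m) (h1 : m < 1) (ht : 0 < t) :
    ∫⁻ x, ENNReal.ofReal (barenblatt m t x ^ m) =
      ENNReal.ofReal (t ^ ((1 - m) / (m + 1)) *
        ∫ y : ℝ, (Dconst m + ktilde m * y ^ 2) ^ (-(m / (1 - m)))) := by
  have h0 : 0 < m := by linarith
  have hD := Dconst_pos h0 h1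
  have hk := ktilde_pos h0 h1
  have ha : 0 < t ^ (-(1 / (m + 1))) := Real.rpow_pos_of_pos ht _
  have hr : 1 < 2 * (m / (1 - m)) := by
    rw [← mul_div_assoc, lt_div_iff₀ (by linarith)]
    linarith
  have hint := integrable_add_mul_sq_rpow_neg hD hk hr
  simp_rw [barenblatt_rpow_self h0 h1 ht]
  rw [← ofReal_integral_eq_lintegral_ofReal ((hint.comp_mul_right' ha.ne').const_mul _)
    (Filter.Eventually.of_forall fun x => by positivity), integral_const_mul,
    Measure.integral_comp_mul_right
      (fun y : ℝ => (Dconst m + ktilde m * y ^ 2) ^ (-(m / (1 - m)))),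
    abs_of_pos (inv_pos.2 ha), smul_eq_mul, ← mul_assoc, ← Real.rpow_neg ht.le,
    ← Real.rpow_add ht]
  congr 3
  ring

/-- for 1/3 < m < 1 there are p ≥ 2 and a constant C_p such that
∫_{(s,ℓ]×ℝ} 𝒰^{p(m-1)/2+1} ≤ C_p (ℓ-s) for all 0 ≤ s < ℓ ≤ T. -/
theorem barenblatt_power_integral_bound
    (m : ℝ) (hm : m ∈ Set.Ioo (1/3 : ℝ) 1) (T : ℝ) (hT : 0 < T) :
    ∃ p : ℝ, 2 ≤ p ∧ ∃ C : ℝ, 0 < C ∧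
      ∀ s ℓ : ℝ, 0 ≤ s → s < ℓ → ℓ ≤ T →
        ∫⁻ q in Set.Ioc s ℓ ×ˢ (Set.univ : Set ℝ),
            ENNReal.ofReal (barenblatt m q.1 q.2 ^ (p * (m - 1) / 2 + 1))
          ≤ ENNReal.ofReal (C * (ℓ - s)) := by
  obtain ⟨hm3, hm1⟩ := hm
  set J := ∫ y : ℝ, (Dconst m + ktilde m * y ^ 2) ^ (-(m / (1 - m)))
  have h0 : 0 < m := by linarith
  have hD := Dconst_pos h0 hm1
  have hk := ktilde_pos h0 hm1
  have hJ0 : 0 ≤ J := integral_nonneg fun y => by positivity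
  have he : 0 ≤ (1 - m) / (m + 1) := div_nonneg (by linarith) (by linarith)
  refine ⟨2, le_rfl, T ^ ((1 - m) / (m + 1)) * J + 1, by positivity, fun s ℓ hs hsl hlT => ?_⟩
  rw [show 2 * (m - 1) / 2 + 1 = m by ring, Measure.volume_eq_prod, ← Measure.prod_restrict,
    Measure.restrict_univ]
  refine (lintegral_prod_le _).trans ?_
  calc ∫⁻ t in Ioc s ℓ, ∫⁻ x, ENNReal.ofReal (barenblatt m t x ^ m)
      ≤ ∫⁻ _ in Ioc s ℓ, ENNReal.ofReal (T ^ ((1 - m) / (m + 1)) * J + 1) := by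
        refine setLIntegral_mono' measurableSet_Ioc fun t ht => ?_
        have ht0 : 0 < t := hs.trans_lt ht.1
        rw [lintegral_barenblatt_rpow_self hm3 hm1 ht0]
        refine ENNReal.ofReal_le_ofReal ?_
        have := mul_le_mul_of_nonneg_right
          (Real.rpow_le_rpow ht0.le (ht.2.trans hlT) he) hJ0
        linarith
    _ = ENNReal.ofReal ((T ^ ((1 - m) / (m + 1)) * J + 1) * (ℓ - s)) := by
        rw [setLIntegral_const, Real.volume_Ioc, ← ENNReal.ofReal_mul (by positivity)]
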